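/- Let E = E_L E_{Z⁺} E_{Z⁻} be a partitioned PBES, let G = (V, E⃗) be a proof graph for core(E) all of whose vertices are labelled by variables in 𝒳_L, and let G′ = (V′, E⃗′) be a proof graph for combine(true(E), G) such that every vertex of G′ labelled by a variable in 𝒳_L belongs to V. Then for every (X, v) ∈ V′, the solution of E satisfies ⟦E⟧(X)(v) = True. -/

import Mathlib

namespace PBESPaper

/-- Fixpoint signs μ and ν. -/
inductive FixKind : Type where
  | mu : FixKind
  | nu : FixKind
deriving DecidableEq

/-- Predicate formulas: atomic predicates, applications of predicate variables to a
data term, conjunction, disjunction, and existential/universal quantification over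
a data variable.  Note: no negation. -/
inductive PForm (D Var PV : Type*) where
  | atom (b : (Var → D) → Prop)
  | app (Y : PV) (e : (Var → D) → D)
  | conj (φ ψ : PForm D Var PV)
  | disj (φ ψ : PForm D Var PV)
  | ex (d : Var) (φ : PForm D Var PV)
  | all (d : Var) (φ : PForm D Var PV)

variable {D Var PV : Type*}

/-- Predicate environments. -/
abbrev PEnv (D PV : Type*) := PV → D → Prop

/-- Data environments. -/
abbrev DEnv (D Var : Type*) := Var → D

/-- Semantic predicate functions, used for (semantic) substitution. -/
abbrev SemPred (D Var PV : Type*) := PEnv D PV → DEnv D Var → D → Prop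

/-- The semantics ⟦φ⟧ηδ of a predicate formula. -/
def PForm.sem [DecidableEq Var] : PForm D Var PV → PEnv D PV → DEnv D Var → Prop
  | .atom b, _, δ => b δ
  | .app Y e, η, δ => η Y (e δ)
  | .conj φ ψ, η, δ => PForm.sem φ η δ ∧ PForm.sem ψ η δ
  | .disj φ ψ, η, δ => PForm.sem φ η δ ∨ PForm.sem ψ η δ
  | .ex d φ, η, δ => ∃ v : D, PForm.sem φ η (Function.update δ d v)
  | .all d φ, η, δ => ∀ v : D, PForm.sem φ η (Function.update δ d v)

/-- The substituted semantics ⟦φ[...]⟧ηδ, where every predicate variable `Y` is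
(simultaneously) interpreted by the semantic predicate function `S Y`. -/
def PForm.semSub [DecidableEq Var] (S : PV → SemPred D Var PV) :
    PForm D Var PV → PEnv D PV → DEnv D Var → Prop
  | .atom b, _, δ => b δ
  | .app Y e, η, δ => S Y η δ (e δ)
  | .conj φ ψ, η, δ => PForm.semSub S φ η δ ∧ PForm.semSub S ψ η δ
  | .disj φ ψ, η, δ => PForm.semSub S φ η δ ∨ PForm.semSub S ψ η δ
  | .ex d φ, η, δ => ∃ v : D, PForm.semSub S φ η (Function.update δ d v)
  | .all d φ, η, δ => ∀ v : D, PForm.semSub S φ η (Function.update δ d v)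

/-- The identity substitution: `Y` is interpreted as `η Y`, i.e. left unchanged. -/
def idSub : PV → SemPred D Var PV := fun Y η _ a => η Y a

/-- Substitution of a single predicate variable `Y` by `P`; all other predicate
variables are left unchanged, so `PForm.semSub (subst1 Y P) φ` is ⟦φ[Y := P]⟧. -/
def subst1 [DecidableEq PV] (Y : PV) (P : SemPred D Var PV) : PV → SemPred D Var PV :=
  fun Z => if Z = Y then P else idSub Z

/-- `d` is unbound in `φ`: no quantifier over `d` occurs in `φ`. -/
def PForm.unbound (d : Var) : PForm D Var PV → Prop
  | .atom _ => True
  | .app _ _ => True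
  | .conj φ ψ => PForm.unbound d φ ∧ PForm.unbound d ψ
  | .disj φ ψ => PForm.unbound d φ ∧ PForm.unbound d ψ
  | .ex d' φ => d' ≠ d ∧ PForm.unbound d φ
  | .all d' φ => d' ≠ d ∧ PForm.unbound d φ

/-- The combine predicate P_{V,E,d,Y}, modelling the substitution of
λe.⋀_{w∈V}(d ≈ w ⟹ e ∈ E_w ∧ Y(e)) for Y. -/
def combinePred (V : Set D) (E : D → Set D) (d : Var) (Y : PV) : SemPred D Var PV :=
  fun η δ a => ∀ w ∈ V, δ d = w → (a ∈ E w ∧ η Y a)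

/-- A PBES: a finite sequence of equations (σᵢ, Xᵢ, φᵢ) with pairwise distinct
bound variables, and a common parameter variable that is unbound in every
right-hand side. -/
structure PBES (D Var PV : Type*) where
  eqns : List (FixKind × PV × PForm D Var PV)
  param : Var
  nodup : (eqns.map fun e => e.2.1).Nodup
  unbound_param : ∀ e ∈ eqns, PForm.unbound param e.2.2

/-- The set of bound predicate variables of a PBES. -/
def PBES.bnd (E : PBES D Var PV) : Set PV := {X | ∃ e ∈ E.eqns, e.2.1 = X}

/-- The signature of a PBES: pairs (X, v) with X bound in E and v a data value. -/
def PBES.sig (E : PBES D Var PV) : Set (PV × D) := {p | p.1 ∈ E.bnd}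

/-- `rk` is a rank function for `E`: the rank of a bound variable is even iff its
sign is ν, and ranks are monotone in the order of the equations. -/
def IsRankFn (E : PBES D Var PV) (rk : PV → ℕ) : Prop :=
  (∀ e ∈ E.eqns, (Even (rk e.2.1) ↔ e.1 = FixKind.nu)) ∧
  (∀ i j : Fin E.eqns.length, (i : ℕ) ≤ (j : ℕ) →
    rk (E.eqns.get i).2.1 ≤ rk (E.eqns.get j).2.1)

/-- The predicate variable `X` occurs infinitely often on the path `π`. -/
def InfOften (π : ℕ → PV × D) (X : PV) : Prop := ∀ n : ℕ, ∃ m, n ≤ m ∧ (π m).1 = X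

/-- `(V, Ed)` is a proof graph for the PBES obtained from `E` by replacing the
right-hand side `φ_X` of each equation by its substituted semantics under `Sf X`
(taking `Sf = fun _ => idSub` yields proof graphs for `E` itself):
(1) every vertex is labelled by a bound variable, edges connect vertices,
(2) for every vertex (X,v) and every δ, the (substituted) right-hand side of X
holds in the environment induced by the successors of (X,v), with the parameter
set to v, and (3) on every infinite path the minimum rank among the variables
occurring infinitely often is even. -/
def IsProofGraph [DecidableEq Var] (E : PBES D Var PV) (Sf : PV → PV → SemPred D Var PV)
    (V : Set (PV × D)) (Ed : Set ((PV × D) × (PV × D))) : Prop :=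
  (∀ p ∈ V, p.1 ∈ E.bnd) ∧
  (∀ e ∈ Ed, e.1 ∈ V ∧ e.2 ∈ V) ∧
  (∀ X : PV, ∀ v : D, (X, v) ∈ V → ∀ σ : FixKind, ∀ φ : PForm D Var PV,
      (σ, X, φ) ∈ E.eqns → ∀ δ : DEnv D Var,
      PForm.semSub (Sf X) φ (fun Y w => ((X, v), (Y, w)) ∈ Ed) (Function.update δ E.param v)) ∧
  (∀ rk : PV → ℕ, IsRankFn E rk →
    ∀ π : ℕ → PV × D, (∀ n : ℕ, (π n, π (n + 1)) ∈ Ed) →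
      Even (sInf (rk '' {X : PV | InfOften π X})))

/-- The identity substitution assignment: each equation keeps its right-hand side. -/
def idAssign : PV → PV → SemPred D Var PV := fun _ => idSub

/-- The solution of the PBES determined by `E` and the substitution assignment `Sf`:
⟦E⟧(X)(v) holds iff X is bound and (X,v) belongs to some proof graph. -/
def sol [DecidableEq Var] (E : PBES D Var PV) (Sf : PV → PV → SemPred D Var PV)
    (X : PV) (v : D) : Prop :=
  X ∈ E.bnd ∧ ∃ V Ed, IsProofGraph E Sf V Ed ∧ (X, v) ∈ V

/-- `E = E_L E_{Z⁺} E_{Z⁻}` is partitioned: the bound variables are partitioned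
into 𝒳_L (the prefix E_L), 𝒵⁺ (equations (ν, Z, true)) and 𝒵⁻ (equations
(μ, Z, false)). -/
structure Partitioned (E : PBES D Var PV) (XL Zp Zm : Set PV) : Prop where
  disjLp : Disjoint XL Zp
  disjLm : Disjoint XL Zm
  disjpm : Disjoint Zp Zm
  cover : E.bnd = XL ∪ Zp ∪ Zm
  shape : ∃ lL lp lm : List (FixKind × PV × PForm D Var PV),
      E.eqns = lL ++ lp ++ lm ∧
      (∀ e ∈ lL, e.2.1 ∈ XL) ∧ (∀ e ∈ lp, e.2.1 ∈ Zp) ∧ (∀ e ∈ lm, e.2.1 ∈ Zm)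
  zp_rhs : ∀ e ∈ E.eqns, e.2.1 ∈ Zp → e.1 = FixKind.nu ∧ e.2.2 = PForm.atom (fun _ => True)
  zm_rhs : ∀ e ∈ E.eqns, e.2.1 ∈ Zm → e.1 = FixKind.mu ∧ e.2.2 = PForm.atom (fun _ => False)

open Classical in
/-- The substitution assignment of core(E): every Z ∈ 𝒵⁺ is replaced by the
semantic predicate constantly True, every Z ∈ 𝒵⁻ by the one constantly False. -/
noncomputable def coreSub (Zp Zm : Set PV) : PV → PV → SemPred D Var PV :=
  fun _X Z =>
    if Z ∈ Zp then fun _ _ _ => True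
    else if Z ∈ Zm then fun _ _ _ => False
    else idSub Z

open Classical in
/-- The substitution assignment of true(E): every Z ∈ 𝒵⁻ is replaced by the
semantic predicate constantly False. -/
noncomputable def trueSub (Zm : Set PV) : PV → PV → SemPred D Var PV :=
  fun _X Z => if Z ∈ Zm then fun _ _ _ => False else idSub Z

open Classical in
/-- The substitution assignment of combine(true(E), G) for a graph G = (VG, EdG):
in the right-hand side of the equation for X, every Z ∈ 𝒵⁻ is replaced by False
(this is true(E)), and every bound variable Y ∉ 𝒵⁺ ∪ 𝒵⁻ is replaced by the
predicate P_Y η δ a := ∀ v, (X,v) ∈ VG → δ(d) = v → (a ∈ E_{X(v),Y} ∧ η Y a),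
where E_{X(v),Y} = { w | ((X,v),(Y,w)) ∈ EdG }. -/
noncomputable def combineTrueSub (E : PBES D Var PV) (Zp Zm : Set PV)
    (VG : Set (PV × D)) (EdG : Set ((PV × D) × (PV × D))) :
    PV → PV → SemPred D Var PV :=
  fun X Y =>
    if Y ∈ Zm then fun _ _ _ => False
    else if Y ∈ Zp then idSub Y
    else if Y ∈ E.bnd then
      fun η δ a => ∀ v : D, (X, v) ∈ VG → δ E.param = v →
        (((X, v), (Y, a)) ∈ EdG ∧ η Y a)
    else idSub Y


theorem semSub_mono_param [DecidableEq Var] (S T : PV → SemPred D Var PV) (d : Var) (v : D)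
    (η : PEnv D PV)
    (h : ∀ Y (δ : DEnv D Var) a, δ d = v → S Y η δ a → T Y η δ a) :
    ∀ (φ : PForm D Var PV), PForm.unbound d φ → ∀ δ : DEnv D Var, δ d = v →
      PForm.semSub S φ η δ → PForm.semSub T φ η δ := by
  intro φ
  induction φ with
  | atom b => intro _ δ _ hs; exact hs
  | app Y e => intro _ δ hd hs; exact h Y δ _ hd hs
  | conj φ ψ ih1 ih2 =>
    intro hu δ hd hs
    exact ⟨ih1 hu.1 δ hd hs.1, ih2 hu.2 δ hd hs.2⟩
  | disj φ ψ ih1 ih2 =>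
    intro hu δ hd hs
    exact hs.imp (ih1 hu.1 δ hd) (ih2 hu.2 δ hd)
  | ex d' φ ih =>
    intro hu δ hd hs
    obtain ⟨w, hw⟩ := hs
    exact ⟨w, ih hu.2 _ (by rw [Function.update_of_ne (Ne.symm hu.1)]; exact hd) hw⟩
  | all d' φ ih =>
    intro hu δ hd hs w
    exact ih hu.2 _ (by rw [Function.update_of_ne (Ne.symm hu.1)]; exact hd) (hs w)

/-- if G = (V, E⃗) is a proof graph for core(E) with all vertices
labelled in 𝒳_L, and G′ = (V′, E⃗′) is a proof graph for combine(true(E), G)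
whose 𝒳_L-labelled vertices all belong to V, then every vertex of G′ is true in
the solution of E. -/
theorem sol_of_mem_proofGraph_combine
    {D Var PV : Type*} [DecidableEq Var] [DecidableEq PV]
    (E : PBES D Var PV) (XL Zp Zm : Set PV) (hpart : Partitioned E XL Zp Zm)
    (V : Set (PV × D)) (Ed : Set ((PV × D) × (PV × D)))
    (hG : IsProofGraph E (coreSub Zp Zm) V Ed)
    (hXL : ∀ p ∈ V, p.1 ∈ XL)
    (V' : Set (PV × D)) (Ed' : Set ((PV × D) × (PV × D)))
    (hG' : IsProofGraph E (combineTrueSub E Zp Zm V Ed) V' Ed')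
    (hXL' : ∀ p ∈ V', p.1 ∈ XL → p ∈ V) :
    ∀ X : PV, ∀ v : D, (X, v) ∈ V' → sol E idAssign X v := by
  obtain ⟨h1, h2, h3, h4⟩ := hG'
  intro X v hXv
  refine ⟨h1 _ hXv, V', Ed', ⟨h1, h2, ?_, h4⟩, hXv⟩
  intro X v hv σ φ hφ δ
  have hs := h3 X v hv σ φ hφ δ
  have hb : X ∈ XL ∪ Zp ∪ Zm := hpart.cover ▸ h1 _ hv
  rcases hb with (hL | hp) | hm
  · have hV := hXL' _ hv hL
    refine semSub_mono_param _ _ E.param v _ ?_ φ (E.unbound_param _ hφ) _ (by simp) hs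
    intro Y δ a hd hc
    simp only [combineTrueSub] at hc
    simp only [idAssign, idSub]
    split_ifs at hc
    · exact hc.elim
    · exact hc
    · exact (hc v hV hd).2
    · exact hc
  · have := (hpart.zp_rhs _ hφ hp).2
    simp only at this
    subst this
    exact trivial
  · have := (hpart.zm_rhs _ hφ hm).2
    simp only at this
    subst this
    exact hs.elim

end PBESPaper
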